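/- Let G be a contracting self-similar inverse semigroup acting by partial bijections with clopen domains on a topological Markov chain F, assume every x ∈ F lies in the domain of some element of G, and let 𝒩 be a semi-nucleus. If e = ⋯e₋₂e₋₁ and f = ⋯f₋₂f₋₁ in F⁻ satisfy e ∼ₐₑ f, then the witnessing data can be chosen so that every gₙ lies in 𝒩, and there exist w ∈ F and h ∈ 𝒩, independent of n, such that gₙ·(e₋ₙ⋯e₋₂e₋₁w) = f₋ₙ⋯f₋₂f₋₁(h·w) for every n. In particular, ∼ₐₑ is symmetric. -/

import Mathlib

open Set Topology
open scoped Pointwise Classical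

noncomputable section

/-! ### Finite graphs and topological Markov chains -/

structure FinGraph where
  V : Type
  E : Type
  fintypeV : Fintype V
  fintypeE : Fintype E
  s : E → V
  r : E → V

/-- Right-infinite (left-pointing) paths `e₀e₁e₂⋯` with `s eᵢ = r eᵢ₊₁`. -/
def IsPath (Γ : FinGraph) (γ : ℕ → Γ.E) : Prop := ∀ n, Γ.s (γ n) = Γ.r (γ (n + 1))

/-- Left-infinite paths `⋯e₋₃e₋₂e₋₁` with `r eᵢ = s eᵢ₋₁`; position `n` records `e₋₍ₙ₊₁₎`. -/
def IsNegPath (Γ : FinGraph) (γ : ℕ → Γ.E) : Prop := ∀ n, Γ.r (γ n) = Γ.s (γ (n + 1))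

abbrev PathSpace (Γ : FinGraph) := {γ : ℕ → Γ.E // IsPath Γ γ}

abbrev NegPathSpace (Γ : FinGraph) := {γ : ℕ → Γ.E // IsNegPath Γ γ}

/-- The product topology on sequences of edges, the edge set being discrete. -/
def seqTop (Γ : FinGraph) : TopologicalSpace (ℕ → Γ.E) :=
  @Pi.topologicalSpace ℕ (fun _ => Γ.E) (fun _ => ⊥)

instance pathSpaceTop (Γ : FinGraph) : TopologicalSpace (PathSpace Γ) :=
  TopologicalSpace.induced Subtype.val (seqTop Γ)

instance negPathSpaceTop (Γ : FinGraph) : TopologicalSpace (NegPathSpace Γ) :=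
  TopologicalSpace.induced Subtype.val (seqTop Γ)

/-- Prepend a single edge to a right-infinite word. -/
def cons (Γ : FinGraph) (x : Γ.E) (w : ℕ → Γ.E) : ℕ → Γ.E :=
  fun n => Nat.casesOn n x w

/-- `x·S`: the set of valid infinite paths of the form `xw` with `w ∈ S`. -/
def consSet (Γ : FinGraph) (x : Γ.E) (S : Set (ℕ → Γ.E)) : Set (ℕ → Γ.E) :=
  (cons Γ x '' S) ∩ {γ | IsPath Γ γ}

/-- A finite word (written left to right, composition order). -/
def IsWord (Γ : FinGraph) (l : List Γ.E) : Prop :=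
  l.Chain' fun a b => Γ.s a = Γ.r b

/-- Append a finite word in front of a right-infinite word. -/
def wordAppend (Γ : FinGraph) (l : List Γ.E) (w : ℕ → Γ.E) : ℕ → Γ.E :=
  fun n => if h : n < l.length then l.get ⟨n, h⟩ else w (n - l.length)

/-- The finite word `e₋ₙ ⋯ e₋₂e₋₁` extracted from a left-infinite word. -/
def negWord (Γ : FinGraph) (e : ℕ → Γ.E) (n : ℕ) : List Γ.E :=
  (List.range n).reverse.map e

/-- The left shift on left-infinite paths, `⋯e₋₃e₋₂e₋₁ ↦ ⋯e₋₄e₋₃e₋₂`. -/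
def shiftNeg (Γ : FinGraph) (γ : NegPathSpace Γ) : NegPathSpace Γ :=
  ⟨fun n => γ.val (n + 1), fun n => γ.prop (n + 1)⟩

section Actions

variable (Γ : FinGraph) {G : Type*}
  (dom : G → Set (ℕ → Γ.E)) (act : G → (ℕ → Γ.E) → (ℕ → Γ.E))

/-- Bartholdi–Grigorchuk–Nekrashevych self-similarity of an action by partial
bijections on a topological Markov chain. -/
def SelfSimilarAction : Prop :=
  ∀ (g : G) (x : Γ.E), ∃ (k : ℕ) (y : Fin k → Γ.E) (h : Fin k → G),
    (∀ i j : Fin k, i ≠ j → Disjoint (dom (h i)) (dom (h j))) ∧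
    (⋃ i : Fin k, consSet Γ x (dom (h i))) = consSet Γ x {γ | IsPath Γ γ} ∩ dom g ∧
    ∀ (i : Fin k) (w : ℕ → Γ.E), IsPath Γ (cons Γ x w) → w ∈ dom (h i) →
      act g (cons Γ x w) = cons Γ (y i) (act (h i) w)

/-- The finite set `N` witnesses contraction of the self-similar action. -/
def ContractsWith (N : Set G) : Prop :=
  N.Finite ∧ ∀ g : G, ∃ k : ℕ, ∀ (u : List Γ.E) (w : ℕ → Γ.E),
    u.length = k → wordAppend Γ u w ∈ dom g →
    ∃ (v : List Γ.E) (h : G), v.length = k ∧ IsWord Γ v ∧ h ∈ N ∧ w ∈ dom h ∧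
      act g (wordAppend Γ u w) = wordAppend Γ v (act h w)

/-- A self-similar action is contracting if some finite subset witnesses contraction. -/
def ContractingAction : Prop := ∃ N : Set G, ContractsWith Γ dom act N

/-- A semi-nucleus: a finite set witnessing contraction, closed under single
restrictions. -/
def IsSemiNucleus (N : Set G) : Prop :=
  ContractsWith Γ dom act N ∧
  ∀ g ∈ N, ∀ (e : Γ.E) (w : ℕ → Γ.E), cons Γ e w ∈ dom g →
    ∃ (f : Γ.E) (h : G), h ∈ N ∧ w ∈ dom h ∧
      act g (cons Γ e w) = cons Γ f (act h w)

/-- Asymptotic equivalence of two left-infinite words with respect to the action. -/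
def AsympEquiv (e f : ℕ → Γ.E) : Prop :=
  ∃ g : ℕ → G, (Set.range g).Finite ∧ ∃ w : ℕ → Γ.E, ∀ n : ℕ,
    wordAppend Γ (negWord Γ e n) w ∈ dom (g n) ∧
    ∀ i : ℕ, i < n →
      act (g n) (wordAppend Γ (negWord Γ e n) w) i = f (n - 1 - i)

end Actions

/-- An inverse semigroup: every element has a unique generalized inverse. -/
def IsInverseSemigroup (G : Type*) [Semigroup G] : Prop :=
  ∀ s : G, ∃! t : G, s * t * s = s ∧ t * s * t = t

/-- An action of an inverse semigroup by partial bijections with clopen domains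
on the topological Markov chain of a finite graph. -/
structure PartialAction (Γ : FinGraph) (G : Type*) [Semigroup G] where
  dom : G → Set (ℕ → Γ.E)
  act : G → (ℕ → Γ.E) → (ℕ → Γ.E)
  dom_path : ∀ g, dom g ⊆ {γ | IsPath Γ γ}
  act_path : ∀ g, ∀ γ ∈ dom g, IsPath Γ (act g γ)
  injOn : ∀ g, Set.InjOn (act g) (dom g)
  dom_clopen : ∀ g, IsClopen {γ : PathSpace Γ | γ.val ∈ dom g}
  dom_mul : ∀ g h, dom (g * h) = {γ ∈ dom h | act h γ ∈ dom g}
  act_mul : ∀ g h, ∀ γ ∈ dom (g * h), act (g * h) γ = act g (act h γ)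

theorem wordAppend_negWord_apply (Γ : FinGraph) (e w : ℕ → Γ.E) (n i : ℕ) :
    wordAppend Γ (negWord Γ e n) w i = if i < n then e (n - 1 - i) else w (i - n) := by
  by_cases h : i < n <;> simp [wordAppend, negWord, h]

theorem wordAppend_negWord_add (Γ : FinGraph) (e w : ℕ → Γ.E) (n m : ℕ) :
    (fun i => wordAppend Γ (negWord Γ e (n + m)) w (i + m)) =
      wordAppend Γ (negWord Γ e n) w := by
  funext i
  simp only [wordAppend_negWord_apply, Nat.add_lt_add_iff_right, Nat.add_sub_add_right]
  rw [show n + m - 1 - (i + m) = n - 1 - i by omega]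

theorem wordAppend_ofFn (Γ : FinGraph) (γ : ℕ → Γ.E) (k : ℕ) :
    wordAppend Γ (List.ofFn fun i : Fin k => γ i) (fun i => γ (i + k)) = γ := by
  funext i
  by_cases h : i < k
  · simp [wordAppend, h]
  · simp [wordAppend, h, Nat.sub_add_cancel (not_lt.1 h)]

theorem wordAppend_length_add (Γ : FinGraph) (l : List Γ.E) (w : ℕ → Γ.E) (i : ℕ) :
    wordAppend Γ l w (i + l.length) = w i := by
  simp [wordAppend]

theorem cons_tail (Γ : FinGraph) (γ : ℕ → Γ.E) :
    cons Γ (γ 0) (fun i => γ (i + 1)) = γ := by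
  funext i
  cases i <;> rfl

section Restriction

variable {Γ : FinGraph} {G : Type*}
  {dom : G → Set (ℕ → Γ.E)} {act : G → (ℕ → Γ.E) → (ℕ → Γ.E)} {N : Set G}

/-- A semi-nucleus is closed under restriction to tails of arbitrary length. -/
theorem IsSemiNucleus.exists_restrict (hN : IsSemiNucleus Γ dom act N) (k : ℕ) :
    ∀ g ∈ N, ∀ γ ∈ dom g, ∃ h ∈ N, (fun i => γ (i + k)) ∈ dom h ∧
      ∀ i, act g γ (i + k) = act h (fun i => γ (i + k)) i := by
  induction k with
  | zero => exact fun g hg γ hγ => ⟨g, hg, hγ, fun _ => rfl⟩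
  | succ k ih =>
    intro g hg γ hγ
    obtain ⟨x, h, hh, hd, ha⟩ := hN.2 g hg (γ 0) (fun i => γ (i + 1)) (by rwa [cons_tail])
    obtain ⟨h', hh', hd', ha'⟩ := ih h hh _ hd
    refine ⟨h', hh', hd', fun i => ?_⟩
    rw [cons_tail] at ha
    rw [ha]
    exact ha' i

/-- Finitely many elements restrict into a semi-nucleus at a common depth. -/
theorem IsSemiNucleus.exists_uniform_restrict (hN : IsSemiNucleus Γ dom act N)
    {S : Set G} (hS : S.Finite) :
    ∃ k : ℕ, ∀ g ∈ S, ∀ γ ∈ dom g, ∃ h ∈ N, (fun i => γ (i + k)) ∈ dom h ∧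
      ∀ i, act g γ (i + k) = act h (fun i => γ (i + k)) i := by
  choose k hk using hN.1.2
  obtain ⟨K, hK⟩ := (hS.image k).bddAbove
  refine ⟨K, fun g hg γ hγ => ?_⟩
  obtain ⟨d, rfl⟩ := Nat.exists_eq_add_of_le' (hK (mem_image_of_mem k hg))
  obtain ⟨v, h, hv, -, hh, hd, ha⟩ := hk g (List.ofFn fun i : Fin (k g) => γ i)
    (fun i => γ (i + k g)) (by simp) (by rwa [wordAppend_ofFn])
  rw [wordAppend_ofFn] at ha
  obtain ⟨h', hh', hd', ha'⟩ := hN.exists_restrict d h hh _ hd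
  simp only [add_assoc] at hd' ha'
  refine ⟨h', hh', hd', fun i => ?_⟩
  rw [← ha' i, ha, ← add_assoc]
  simpa only [hv] using wordAppend_length_add Γ v (act h fun i => γ (i + k g)) (i + d)

end Restriction

theorem PartialAction.mem_dom_and_act_act_of_inverse {Γ : FinGraph} {G : Type*} [Semigroup G]
    (A : PartialAction Γ G) {s t : G} (hst : s * t * s = s) {γ : ℕ → Γ.E} (hγ : γ ∈ A.dom s) :
    A.act s γ ∈ A.dom t ∧ A.act t (A.act s γ) = γ := by
  rw [mul_assoc] at hst
  have h₁ : γ ∈ A.dom (s * (t * s)) := by rwa [hst]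
  have h₂ : γ ∈ A.dom (t * s) ∧ A.act (t * s) γ ∈ A.dom s := by rwa [A.dom_mul] at h₁
  have h₃ : γ ∈ A.dom s ∧ A.act s γ ∈ A.dom t := by
    have := h₂.1
    rwa [A.dom_mul] at this
  have h₄ := A.act_mul s (t * s) γ h₁
  rw [hst] at h₄
  refine ⟨h₃.2, ?_⟩
  rw [← A.act_mul t s γ h₂.1]
  exact (A.injOn s hγ h₂.2 h₄).symm

/-- Asymptotic equivalence is witnessed by a semi-nucleus with a common restriction to the
tail. -/
theorem AsympEquiv.exists_mem_semiNucleus {Γ : FinGraph} {G : Type*}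
    {dom : G → Set (ℕ → Γ.E)} {act : G → (ℕ → Γ.E) → (ℕ → Γ.E)} {N : Set G}
    (hN : IsSemiNucleus Γ dom act N) {e f : ℕ → Γ.E} (hef : AsympEquiv Γ dom act e f) :
    ∃ g : ℕ → G, (∀ n, g n ∈ N) ∧
      ∃ (w : ℕ → Γ.E) (h : G), h ∈ N ∧ w ∈ dom h ∧
        ∀ n : ℕ, wordAppend Γ (negWord Γ e n) w ∈ dom (g n) ∧
          act (g n) (wordAppend Γ (negWord Γ e n) w) =
            wordAppend Γ (negWord Γ f n) (act h w) := by
  obtain ⟨g, hfin, w, hg⟩ := hef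
  obtain ⟨K, hK⟩ := hN.exists_uniform_restrict hfin
  have hp : ∀ n, ∃ p ∈ N, wordAppend Γ (negWord Γ e n) w ∈ dom p ∧
      ∀ i < n, act p (wordAppend Γ (negWord Γ e n) w) i = f (n - 1 - i) := by
    intro n
    obtain ⟨p, hpN, hd, ha⟩ := hK _ (mem_range_self (n + K)) _ (hg (n + K)).1
    rw [wordAppend_negWord_add] at hd ha
    refine ⟨p, hpN, hd, fun i hi => ?_⟩
    rw [← ha i, (hg (n + K)).2 (i + K) (by omega)]
    congr 1
    omega
  choose p hpN hpd hpa using hp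
  have hq : ∀ n, ∃ q ∈ N, w ∈ dom q ∧
      ∀ i, act (p n) (wordAppend Γ (negWord Γ e n) w) (i + n) = act q w i := by
    intro n
    have htail : (fun i => wordAppend Γ (negWord Γ e n) w (i + n)) = w := by
      funext i
      simp [wordAppend_negWord_apply]
    simpa only [htail] using hN.exists_restrict n (p n) (hpN n) _ (hpd n)
  choose q hqN hqd hqa using hq
  have : Finite N := hN.1.1
  obtain ⟨⟨h, hh⟩, hinf⟩ := Finite.exists_infinite_fiber fun n => (⟨q n, hqN n⟩ : N)
  have hlarge : ∀ n, ∃ d, q (n + d) = h := by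
    intro n
    obtain ⟨m, hm, hnm⟩ := (Set.infinite_coe_iff.1 hinf).exists_gt n
    obtain ⟨d, rfl⟩ := Nat.exists_eq_add_of_le hnm.le
    exact ⟨d, congrArg Subtype.val hm⟩
  choose d hd using hlarge
  have hr : ∀ n, ∃ r ∈ N, wordAppend Γ (negWord Γ e n) w ∈ dom r ∧
      act r (wordAppend Γ (negWord Γ e n) w) = wordAppend Γ (negWord Γ f n) (act h w) := by
    intro n
    obtain ⟨r, hrN, hrd, hra⟩ := hN.exists_restrict (d n) _ (hpN (n + d n)) _ (hpd (n + d n))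
    rw [wordAppend_negWord_add] at hrd hra
    refine ⟨r, hrN, hrd, ?_⟩
    funext i
    rw [← hra i, wordAppend_negWord_apply]
    split_ifs with hi
    · rw [hpa _ _ (by omega)]
      congr 1
      omega
    · rw [← hd n, ← hqa]
      congr 1
      omega
  choose r hrN hr using hr
  exact ⟨r, hrN, w, h, hh, hd 0 ▸ hqd _, hr⟩

/-- Let `G` be a contracting self-similar inverse semigroup
acting by partial bijections with clopen domains on a topological Markov chain
`F` (every `x ∈ F` lying in some domain), and let `𝒩` be a semi-nucleus.  If
`e ∼ₐₑ f` then the witnessing data may be chosen with every `gₙ ∈ 𝒩` and with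
`w ∈ F` and `h ∈ 𝒩` independent of `n` such that
`gₙ·(e₋ₙ⋯e₋₁w) = f₋ₙ⋯f₋₁(h·w)` for every `n`.  In particular `∼ₐₑ` is
symmetric. -/
theorem asympEquiv_symm {G : Type*} [Semigroup G] (Γ : FinGraph)
    (hG : IsInverseSemigroup G) (A : PartialAction Γ G)
    (hss : SelfSimilarAction Γ A.dom A.act)
    (hc : ContractingAction Γ A.dom A.act)
    (hdom : ∀ γ : PathSpace Γ, ∃ g : G, γ.val ∈ A.dom g)
    (N : Set G) (hN : IsSemiNucleus Γ A.dom A.act N) :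
    ∀ e f : NegPathSpace Γ, AsympEquiv Γ A.dom A.act e.val f.val →
      (∃ g : ℕ → G, (∀ n, g n ∈ N) ∧
        ∃ (w : ℕ → Γ.E) (h : G), h ∈ N ∧ w ∈ A.dom h ∧
          ∀ n : ℕ, wordAppend Γ (negWord Γ e.val n) w ∈ A.dom (g n) ∧
            A.act (g n) (wordAppend Γ (negWord Γ e.val n) w) =
              wordAppend Γ (negWord Γ f.val n) (A.act h w)) ∧
      AsympEquiv Γ A.dom A.act f.val e.val := by
  intro e f hef
  have key := hef.exists_mem_semiNucleus hN
  refine ⟨key, ?_⟩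
  obtain ⟨g, hg, w, h, -, -, hgw⟩ := key
  choose inv hinv using fun s => (hG s).exists
  refine ⟨fun n => inv (g n), (hN.1.1.image inv).subset ?_, A.act h w, fun n => ?_⟩
  · rintro _ ⟨n, rfl⟩
    exact mem_image_of_mem inv (hg n)
  · obtain ⟨hd, ha⟩ := hgw n
    have hback := A.mem_dom_and_act_act_of_inverse (hinv (g n)).1 hd
    rw [ha] at hback
    refine ⟨hback.1, fun i hi => ?_⟩
    rw [hback.2, wordAppend_negWord_apply, if_pos hi]
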